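/- Let R be a commutative Noetherian ring of prime characteristic p in which every ideal is Frobenius closed (e.g. R is F-pure). Let I be an ideal of R generated by r elements which contains a nonzerodivisor. Then every element of R that is integral over I^{r+1} lies in I; that is, the integral closure of I^{r+1} is contained in I. -/

import Mathlib

open IsLocalRing

/-- The Frobenius power `I^{[q]}`: the ideal generated by the `q`-th powers of
the elements of `I`. -/
def frobeniusPower {R : Type*} [CommRing R] (I : Ideal R) (q : ℕ) : Ideal R :=
  Ideal.span ((fun a => a ^ q) '' (I : Set R))

/-- Every ideal of `R` is Frobenius closed: for every ideal `I`, every `x` and every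
`q = p^e` with `e ≥ 1`, `x^q ∈ I^{[q]}` implies `x ∈ I`. -/
def AllIdealsFrobeniusClosed (R : Type*) [CommRing R] (p : ℕ) : Prop :=
  ∀ (I : Ideal R) (x : R) (e : ℕ), 1 ≤ e → x ^ (p ^ e) ∈ frobeniusPower I (p ^ e) → x ∈ I

/-- `x` is integral over the ideal `I`: there are `n ≥ 1` and `a i ∈ I^i` for
`1 ≤ i ≤ n` with `x^n + a 1 * x^(n-1) + ⋯ + a n = 0`. -/
def IsIntegralOverIdeal {R : Type*} [CommRing R] (x : R) (I : Ideal R) : Prop :=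
  ∃ n : ℕ, 1 ≤ n ∧ ∃ a : ℕ → R, (∀ i, 1 ≤ i → i ≤ n → a i ∈ I ^ i) ∧
    x ^ n + ∑ i ∈ Finset.Icc 1 n, a i * x ^ (n - i) = 0

/-- If `x` satisfies an equation of integral dependence of degree `n` over `J`, then
`x ^ m ∈ J ^ (m + 1 - n)` for all `m`. -/
theorem pow_mem_pow_of_integral_equation {R : Type*} [CommRing R] {J : Ideal R} {x : R} {n : ℕ}
    {a : ℕ → R} (ha : ∀ i, 1 ≤ i → i ≤ n → a i ∈ J ^ i)
    (hx : x ^ n + ∑ i ∈ Finset.Icc 1 n, a i * x ^ (n - i) = 0) (m : ℕ) :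
    x ^ m ∈ J ^ (m + 1 - n) := by
  induction m using Nat.strong_induction_on with
  | _ m ih =>
    rcases lt_or_ge m n with h | h
    · simp [show m + 1 - n = 0 by omega]
    · have hxm : x ^ m = -∑ i ∈ Finset.Icc 1 n, a i * x ^ (m - i) := by
        have hsum : ∑ i ∈ Finset.Icc 1 n, a i * x ^ (m - i) =
            x ^ (m - n) * ∑ i ∈ Finset.Icc 1 n, a i * x ^ (n - i) := by
          rw [Finset.mul_sum]
          refine Finset.sum_congr rfl fun i hi => ?_
          have hi' := (Finset.mem_Icc.mp hi).2
          rw [show m - i = (m - n) + (n - i) by omega, pow_add]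
          ring
        have hpow : x ^ m = x ^ (m - n) * x ^ n := by
          rw [← pow_add, Nat.sub_add_cancel h]
        rw [hsum, hpow]
        linear_combination x ^ (m - n) * hx
      rw [hxm]
      refine neg_mem (sum_mem fun i hi => ?_)
      obtain ⟨h1, h2⟩ := Finset.mem_Icc.mp hi
      refine Ideal.pow_le_pow_right (show m + 1 - n ≤ i + (m - i + 1 - n) by omega) ?_
      rw [pow_add]
      exact Ideal.mul_mem_mul (ha i h1 h2) (ih (m - i) (by omega))

/-- A high power of an ideal generated by a finite set is contained in the ideal generated by
the `q`-th powers of the generators. -/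
theorem span_pow_card_mul_add_one_le {R : Type*} [CommRing R] (s : Finset R) (q : ℕ) :
    Ideal.span (s : Set R) ^ (s.card * q + 1) ≤ Ideal.span ((fun a => a ^ q) '' (s : Set R)) := by
  classical
  induction s using Finset.induction_on with
  | empty => simp
  | insert a s has ih =>
    rw [Finset.card_insert_of_notMem has, Finset.coe_insert, Set.image_insert_eq,
      Ideal.span_insert, Ideal.span_insert,
      show (s.card + 1) * q + 1 = q + (s.card * q + 1) by ring]
    refine Ideal.sup_pow_add_le_pow_sup_pow.trans (sup_le_sup ?_ ih)
    rw [Ideal.span_singleton_pow]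

/-- If `R` is Noetherian of prime characteristic `p` in which every
ideal is Frobenius closed, and `I` is an ideal generated by `r` elements containing a
nonzerodivisor, then the integral closure of `I^{r+1}` is contained in `I`. -/
theorem integralClosure_pow_succ_subset_of_frobeniusClosed
    {R : Type*} [CommRing R] [IsNoetherianRing R]
    (p : ℕ) [Fact p.Prime] [CharP R p]
    (hFC : AllIdealsFrobeniusClosed R p)
    (I : Ideal R) (r : ℕ) (s : Finset R) (hcard : s.card = r) (hgen : I = Ideal.span s)
    (hnzd : ∃ c ∈ I, c ∈ nonZeroDivisors R)
    (x : R) (hx : IsIntegralOverIdeal x (I ^ (r + 1))) :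
    x ∈ I := by
  subst hcard hgen
  obtain ⟨n, -, a, ha, hsum⟩ := hx
  obtain ⟨e, he, hq⟩ : ∃ e, 1 ≤ e ∧ (s.card + 1) * n + 1 ≤ p ^ e :=
    ⟨(s.card + 1) * n + 1, by omega, (Nat.lt_pow_self (Fact.out : p.Prime).one_lt).le⟩
  refine hFC _ x e he ?_
  have hle : s.card * p ^ e + 1 ≤ (s.card + 1) * (p ^ e + 1 - n) := by
    have hn : n ≤ p ^ e + 1 := by nlinarith
    zify [hn] at hq ⊢
    nlinarith
  have hmem := pow_mem_pow_of_integral_equation ha hsum (p ^ e)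
  rw [← pow_mul] at hmem
  exact Ideal.span_mono (Set.image_mono Ideal.subset_span)
    (span_pow_card_mul_add_one_le s _ (Ideal.pow_le_pow_right hle hmem))
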